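/- Let E be a real inner product space, J : E → ℝ differentiable with gradient ∇J that is L-Lipschitz (L > 0). Let (Ω, 𝒜, P) be a probability space with a sub-σ-algebra 𝓕, W an 𝓕-measurable E-valued random variable, G an E-valued random variable with E[G | 𝓕] = ∇J(W) a.s. and E[‖G − ∇J(W)‖² | 𝓕] ≤ σ² a.s., with J(W), ‖G‖², and J(W − ηG) integrable. Then for any step size η ∈ (0, 1/L], almost surely E[J(W − η·G) | 𝓕] ≤ J(W) − (η/2)·‖∇J(W)‖² + (L·η²/2)·σ². -/

import Mathlib

open MeasureTheory

/-- Quadratic upper bound for a function with `L`-Lipschitz gradient. -/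
theorem le_add_inner_gradient_add_of_lipschitz_gradient
    {E : Type*} [NormedAddCommGroup E] [InnerProductSpace ℝ E] [CompleteSpace E]
    {J : E → ℝ} {L : ℝ} (hdiff : Differentiable ℝ J)
    (hlip : ∀ x y : E, ‖gradient J x - gradient J y‖ ≤ L * ‖x - y‖) (x v : E) :
    J (x + v) ≤ J x + inner ℝ (gradient J x) v + L / 2 * ‖v‖ ^ 2 := by
  let φ : ℝ → ℝ := fun t =>
    J (x + t • v) - t * inner ℝ (gradient J x) v - L / 2 * ‖v‖ ^ 2 * t ^ 2
  have hφ : ∀ t, HasDerivAt φ (inner ℝ (gradient J (x + t • v)) v -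
      inner ℝ (gradient J x) v - L * ‖v‖ ^ 2 * t) t := by
    intro t
    have hline : HasDerivAt (fun s : ℝ => x + s • v) v t := by
      simpa using ((hasDerivAt_id t).smul_const v).const_add x
    have hJ := (hdiff (x + t • v)).hasFDerivAt.comp_hasDerivAt t hline
    rw [← inner_gradient_left] at hJ
    have hlin := (hasDerivAt_id t).mul_const (inner ℝ (gradient J x) v)
    have hsq := (hasDerivAt_pow 2 t).const_mul (L / 2 * ‖v‖ ^ 2)
    refine ((hJ.sub hlin).sub hsq).congr_deriv ?_
    push_cast
    ring
  have hanti : AntitoneOn φ (Set.Icc 0 1) := by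
    refine antitoneOn_of_deriv_nonpos (convex_Icc 0 1)
      (fun t _ => (hφ t).continuousAt.continuousWithinAt)
      (fun t _ => (hφ t).differentiableAt.differentiableWithinAt) fun t ht => ?_
    rw [interior_Icc] at ht
    rw [(hφ t).deriv, ← inner_sub_left]
    have hgrad := hlip (x + t • v) x
    rw [add_sub_cancel_left, norm_smul, Real.norm_of_nonneg ht.1.le] at hgrad
    have hcs := real_inner_le_norm (gradient J (x + t • v) - gradient J x) v
    have hmul := mul_le_mul_of_nonneg_right hgrad (norm_nonneg v)
    linarith
  have h01 := hanti (Set.left_mem_Icc.2 zero_le_one) (Set.right_mem_Icc.2 zero_le_one) zero_le_one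
  simp only [φ, one_smul, zero_smul, add_zero] at h01
  linarith

/-- If `f` is a version of `μ[G | m]`, then the square-integrable `G` pairs with `f` as expected
of an orthogonal projection. When `G` is not a.e. strongly measurable, `f` vanishes a.e. -/
theorem integrable_and_condExp_inner_of_condExp_ae_eq
    {E : Type*} [NormedAddCommGroup E] [InnerProductSpace ℝ E] [CompleteSpace E]
    {Ω : Type*} {m mΩ : MeasurableSpace Ω} {μ : Measure Ω} [IsFiniteMeasure μ]
    {f G : Ω → E} (hf : StronglyMeasurable[m] f) (hmean : μ[G | m] =ᵐ[μ] f)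
    (hG2 : Integrable (fun ω => ‖G ω‖ ^ 2) μ) :
    Integrable (fun ω => ‖f ω‖ ^ 2) μ ∧ Integrable (fun ω => ‖G ω - f ω‖ ^ 2) μ ∧
      Integrable (fun ω => (inner ℝ (f ω) (G ω) : ℝ)) μ ∧
      μ[fun ω => (inner ℝ (f ω) (G ω) : ℝ) | m] =ᵐ[μ] fun ω => ‖f ω‖ ^ 2 := by
  by_cases hG : AEStronglyMeasurable G μ
  · have hGL : MemLp G 2 μ := (memLp_two_iff_integrable_sq_norm hG).2 hG2
    have hfL : MemLp f 2 μ := (hGL.condExp one_le_two).ae_eq hmean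
    have hinner : Integrable (fun ω => (inner ℝ (f ω) (G ω) : ℝ)) μ := by
      refine (hfL.norm.integrable_mul hGL.norm).mono' (hfL.1.inner hG) (.of_forall fun ω => ?_)
      exact norm_inner_le_norm (f ω) (G ω)
    refine ⟨hfL.integrable_norm_pow two_ne_zero, (hGL.sub hfL).integrable_norm_pow two_ne_zero,
      hinner, ?_⟩
    filter_upwards [condExp_bilin_of_stronglyMeasurable_left (innerSL ℝ) hf hinner
      (hGL.integrable one_le_two), hmean] with ω h₁ h₂
    rw [h₂] at h₁
    exact h₁.trans (real_inner_self_eq_norm_sq (f ω))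
  · have hf0 : f =ᵐ[μ] 0 := by
      rw [condExp_of_not_integrable fun h => hG h.1] at hmean
      exact hmean.symm
    have hinner : (fun ω => (inner ℝ (f ω) (G ω) : ℝ)) =ᵐ[μ] 0 := by
      filter_upwards [hf0] with ω h
      simp [h]
    have hsq : (fun ω => ‖f ω‖ ^ 2) =ᵐ[μ] 0 := by
      filter_upwards [hf0] with ω h
      simp [h]
    refine ⟨(integrable_zero Ω ℝ μ).congr hsq.symm, hG2.congr ?_,
      (integrable_zero Ω ℝ μ).congr hinner.symm, ?_⟩
    · filter_upwards [hf0] with ω h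
      simp [h]
    · refine (condExp_congr_ae hinner).trans ?_
      rw [condExp_zero]
      exact hsq.symm

/-- **One-step descent lemma for SGD**: for an `L`-smooth objective `J`, an `𝓕`-measurable
iterate `W`, and a stochastic gradient `G` that is conditionally unbiased with conditional
variance at most `σ²`, a step of size `η ∈ (0, 1/L]` satisfies, almost surely,
`E[J(W - η G) | 𝓕] ≤ J(W) - (η/2) ‖∇J(W)‖² + (L η²/2) σ²`. -/
theorem sgd_one_step_descent
    {E : Type*} [NormedAddCommGroup E] [InnerProductSpace ℝ E] [CompleteSpace E]
    {Ω : Type*} {mΩ : MeasurableSpace Ω} {μ : Measure Ω} [IsProbabilityMeasure μ]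
    {m : MeasurableSpace Ω} (hm : m ≤ mΩ)
    (J : E → ℝ) (L σ η : ℝ)
    (hL : 0 < L)
    (hdiff : Differentiable ℝ J)
    (hlip : ∀ x y : E, ‖gradient J x - gradient J y‖ ≤ L * ‖x - y‖)
    (W G : Ω → E)
    (hWmeas : StronglyMeasurable[m] W)
    (hmean : μ[G | m] =ᵐ[μ] fun ω => gradient J (W ω))
    (hvar : ∀ᵐ ω ∂μ,
      (μ[fun ω' => ‖G ω' - gradient J (W ω')‖ ^ 2 | m]) ω ≤ σ ^ 2)
    (hJW : Integrable (fun ω => J (W ω)) μ)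
    (hG2 : Integrable (fun ω => ‖G ω‖ ^ 2) μ)
    (hJWG : Integrable (fun ω => J (W ω - η • G ω)) μ)
    (hη : 0 < η) (hηL : η ≤ 1 / L) :
    ∀ᵐ ω ∂μ, (μ[fun ω' => J (W ω' - η • G ω') | m]) ω
      ≤ J (W ω) - η / 2 * ‖gradient J (W ω)‖ ^ 2 + L * η ^ 2 / 2 * σ ^ 2 := by
  have hJc : Continuous J := hdiff.continuous
  have hgrad : Continuous (gradient J) :=
    (LipschitzWith.of_dist_le_mul (K := L.toNNReal) fun x y => by
      simpa [dist_eq_norm, hL.le] using hlip x y).continuous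
  have hf : StronglyMeasurable[m] fun ω => gradient J (W ω) := hgrad.comp_stronglyMeasurable hWmeas
  obtain ⟨hf2, hdev, hinner, hcond⟩ :=
    integrable_and_condExp_inner_of_condExp_ae_eq hf hmean hG2
  let A : Ω → ℝ := fun ω => J (W ω) - L * η ^ 2 / 2 * ‖gradient J (W ω)‖ ^ 2
  let B : Ω → ℝ := fun ω => inner ℝ (gradient J (W ω)) (G ω)
  let D : Ω → ℝ := fun ω => ‖G ω - gradient J (W ω)‖ ^ 2
  have hA : Integrable A μ := hJW.sub (hf2.const_mul _)
  have hAm : StronglyMeasurable[m] A :=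
    (hJc.comp_stronglyMeasurable hWmeas).sub ((hf.norm.pow 2).const_mul _)
  have hB : Integrable ((L * η ^ 2 - η) • B) μ := hinner.smul _
  have hD : Integrable ((L * η ^ 2 / 2) • D) μ := hdev.smul _
  have hstep : ∀ ω, J (W ω - η • G ω) ≤ (A + (L * η ^ 2 - η) • B + (L * η ^ 2 / 2) • D) ω := by
    intro ω
    have h := le_add_inner_gradient_add_of_lipschitz_gradient hdiff hlip (W ω) (-(η • G ω))
    have hsq := norm_sub_sq_real (G ω) (gradient J (W ω))
    rw [real_inner_comm] at hsq
    rw [← sub_eq_add_neg, inner_neg_right, inner_smul_right, norm_neg, norm_smul, mul_pow,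
      Real.norm_eq_abs, sq_abs] at h
    simp only [A, B, D, Pi.add_apply, Pi.smul_apply, smul_eq_mul, hsq]
    linarith
  filter_upwards [condExp_mono (m := m) hJWG ((hA.add hB).add hD) (.of_forall hstep),
    condExp_add (hA.add hB) hD m, condExp_add hA hB m, condExp_smul (L * η ^ 2 - η) B m,
    condExp_smul (L * η ^ 2 / 2) D m, hcond, hvar] with ω hle hadd hadd' hsB hsD hcB hcD
  rw [hadd, Pi.add_apply, hadd', Pi.add_apply, hsB, hsD, Pi.smul_apply, Pi.smul_apply, hcB,
    condExp_of_stronglyMeasurable hm hAm hA, smul_eq_mul, smul_eq_mul] at hle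
  have hvar' := mul_le_mul_of_nonneg_left hcD (by positivity : 0 ≤ L * η ^ 2 / 2)
  have hLη : L * η ^ 2 ≤ η := by
    rw [le_div_iff₀ hL] at hηL
    nlinarith
  have hdesc := mul_le_mul_of_nonneg_right hLη (sq_nonneg ‖gradient J (W ω)‖)
  simp only [A, D] at hle
  linarith
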